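/- For every κ > 0, with (E¹_{θ,κ}, E²_{θ,κ}, E³_{θ,κ}) the unique solution for small θ of the laminate system (i)–(v) with σ³ = 2I + J, one has lim_{θ→0⁺} θ·Δ₁₂(E³_{θ,κ}) = −2κ/17 and lim_{θ→0⁺} θ·Δ₁₂(E²_{θ,κ}) = 2κ/17; in particular, for every κ > 0 there exists θ₀ > 0 such that for 0 < θ < θ₀ the determinants Δ₁₂(E²_{θ,κ}) and Δ₁₂(E³_{θ,κ}) are nonzero with opposite signs. -/

import Mathlib

open Matrix

noncomputable section

/-- The matrix `J` with `J₁₂ = -1`, `J₂₁ = 1`, all other entries `0`. -/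
def Jmat : Matrix (Fin 3) (Fin 3) ℝ := !![0, -1, 0; 1, 0, 0; 0, 0, 0]

/-- The lamination direction `ξ¹_θ = (0, θ/√(1+θ²), 1/√(1+θ²))`. -/
def xi1 (θ : ℝ) : Fin 3 → ℝ :=
  ![0, θ / Real.sqrt (1 + θ ^ 2), 1 / Real.sqrt (1 + θ ^ 2)]

/-- The lamination direction `ξ² = (0, 1/√2, 1/√2)`. -/
def xi2 : Fin 3 → ℝ := ![0, 1 / Real.sqrt 2, 1 / Real.sqrt 2]

/-- The phase `σ¹_{θ,κ} = diag(κθ⁻², κθ⁻², 1)`. -/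
def sig1 (θ κ : ℝ) : Matrix (Fin 3) (Fin 3) ℝ :=
  !![κ / θ ^ 2, 0, 0; 0, κ / θ ^ 2, 0; 0, 0, 1]

/-- The phase `σ² = I`. -/
def sig2 : Matrix (Fin 3) (Fin 3) ℝ := 1

/-- The phase `σ³ = 2I + J`. -/
def sig3 : Matrix (Fin 3) (Fin 3) ℝ := (2 : ℝ) • 1 + Jmat

/-- The leading 2×2 minor `Δ₁₂(M) = M₁₁M₂₂ − M₁₂M₂₁`. -/
def Delta12 (M : Matrix (Fin 3) (Fin 3) ℝ) : ℝ :=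
  M 0 0 * M 1 1 - M 0 1 * M 1 0

/-- The linear system (i)–(v) determining the electric fields of the rank-two laminate. -/
def LamSys (θ κ : ℝ) (σ3 : Matrix (Fin 3) (Fin 3) ℝ)
    (E1 E2 E3 : Matrix (Fin 3) (Fin 3) ℝ) (η1 η2 : Fin 3 → ℝ) : Prop :=
  (1 - θ) • E1 + (θ / 2) • (E2 + E3) = 1 ∧
  E2 - E3 = vecMulVec xi2 η2 ∧
  E1 - (1 / 2 : ℝ) • (E2 + E3) = vecMulVec (xi1 θ) η1 ∧
  (sig2 * E2 - σ3 * E3)ᵀ *ᵥ xi2 = 0 ∧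
  (sig1 θ κ * E1 - (1 / 2 : ℝ) • (sig2 * E2 + σ3 * E3))ᵀ *ᵥ xi1 θ = 0

open Filter Topology

/-- The determinant, up to a factor, of the linear system solved by the amplitudes of the laminate
in each column. -/
def lamDen (κ θ : ℝ) : ℝ :=
  θ * (κ + 1) + 3 / 2 * (1 - θ) * (1 + θ ^ 2) - (1 + θ) * (1 - θ ^ 2) / 12

/-- The amplitude of the outer lamination along the direction `(0, θ, 1)`. -/
def outerAmp (κ θ : ℝ) : Fin 3 → ℝ := fun j =>
  (![θ / 2, 3 * θ / 2 - κ / θ, 1 / 2] j - (1 + θ) / 12) / lamDen κ θ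

/-- The amplitude of the inner lamination along the direction `(0, 1, 1)`. -/
def innerAmp (κ θ : ℝ) : Fin 3 → ℝ := fun j => (1 - (1 - θ ^ 2) * outerAmp κ θ j) / 3

/-- The field in the phase with amplitude `a` of the outer lamination, weighted by `s`, and
amplitude `b` of the inner lamination, weighted by `t`. -/
def lamField (θ s t : ℝ) (a b : Fin 3 → ℝ) : Matrix (Fin 3) (Fin 3) ℝ :=
  1 + s • vecMulVec ![0, θ, 1] a + t • vecMulVec ![0, 1, 1] b

lemma lamField_apply (θ s t : ℝ) (a b : Fin 3 → ℝ) (i j : Fin 3) :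
    lamField θ s t a b i j = (1 : Matrix (Fin 3) (Fin 3) ℝ) i j +
      s * (![0, θ, 1] i * a j) + t * (![0, 1, 1] i * b j) := by
  simp only [lamField, Matrix.add_apply, Matrix.smul_apply, vecMulVec_apply, smul_eq_mul]

lemma xi1_eq_smul (θ : ℝ) : xi1 θ = (√(1 + θ ^ 2))⁻¹ • ![0, θ, 1] := by
  ext i; fin_cases i <;> simp [xi1, div_eq_inv_mul]

lemma xi2_eq_smul : xi2 = (√2)⁻¹ • ![0, 1, 1] := by
  ext i; fin_cases i <;> simp [xi2]

lemma transpose_mulVec_smul_eq_zero {c : ℝ} (hc : c ≠ 0) (M : Matrix (Fin 3) (Fin 3) ℝ)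
    (v : Fin 3 → ℝ) : Mᵀ *ᵥ (c • v) = 0 ↔ Mᵀ *ᵥ v = 0 := by
  rw [mulVec_smul, smul_eq_zero_iff_right hc]

lemma inner_flux_eq_zero_iff (θ : ℝ) (a b : Fin 3 → ℝ) :
    (sig2 * lamField θ (-(1 - θ)) (1 / 2) a b -
        sig3 * lamField θ (-(1 - θ)) (-(1 / 2)) a b)ᵀ *ᵥ ![0, 1, 1] = 0 ↔
      ∀ j, (1 - θ ^ 2) * a j + 3 * b j = 1 := by
  rw [funext_iff]
  refine forall_congr' fun j => ?_
  fin_cases j <;>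
  · simp only [mulVec, dotProduct, transpose_apply, Matrix.sub_apply, mul_apply,
      Fin.sum_univ_three, lamField_apply]
    simp [sig2, sig3, Jmat, one_apply]
    constructor <;> intro h <;> linarith

lemma outer_flux_eq_zero_iff {θ : ℝ} (κ : ℝ) (hθ : θ ≠ 0) (a b : Fin 3 → ℝ) :
    (sig1 θ κ * lamField θ θ 0 a b - (1 / 2 : ℝ) • (sig2 * lamField θ (-(1 - θ)) (1 / 2) a b +
        sig3 * lamField θ (-(1 - θ)) (-(1 / 2)) a b))ᵀ *ᵥ ![0, θ, 1] = 0 ↔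
      ∀ j, (θ * (κ + 1) + 3 / 2 * (1 - θ) * (1 + θ ^ 2)) * a j + (1 + θ) / 4 * b j =
        ![θ / 2, 3 * θ / 2 - κ / θ, 1 / 2] j := by
  rw [funext_iff]
  refine forall_congr' fun j => ?_
  fin_cases j <;>
  · simp only [mulVec, dotProduct, transpose_apply, Matrix.sub_apply, Matrix.add_apply, Matrix.smul_apply, mul_apply,
      Fin.sum_univ_three, lamField_apply]
    simp [sig1, sig2, sig3, Jmat, one_apply]
    field_simp
    constructor <;> intro h <;> linarith

lemma amp_system_iff {κ θ : ℝ} (hD : lamDen κ θ ≠ 0) (a b : Fin 3 → ℝ) :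
    ((∀ j, (1 - θ ^ 2) * a j + 3 * b j = 1) ∧
      ∀ j, (θ * (κ + 1) + 3 / 2 * (1 - θ) * (1 + θ ^ 2)) * a j + (1 + θ) / 4 * b j =
        ![θ / 2, 3 * θ / 2 - κ / θ, 1 / 2] j) ↔
      a = outerAmp κ θ ∧ b = innerAmp κ θ := by
  constructor
  · rintro ⟨h1, h2⟩
    have ha : a = outerAmp κ θ := by
      ext j
      rw [outerAmp, eq_div_iff hD, lamDen]
      linear_combination h2 j - (1 + θ) / 12 * h1 j
    refine ⟨ha, ?_⟩
    ext j
    rw [innerAmp, ← ha]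
    linear_combination h1 j / 3
  · rintro ⟨rfl, rfl⟩
    refine ⟨fun j => by rw [innerAmp]; ring, fun j => ?_⟩
    have h : outerAmp κ θ j * lamDen κ θ = _ := div_mul_cancel₀ _ hD
    rw [lamDen] at h
    rw [innerAmp]
    linear_combination h

lemma fields_iff (θ : ℝ) (E1 E2 E3 : Matrix (Fin 3) (Fin 3) ℝ) (a b : Fin 3 → ℝ) :
    ((1 - θ) • E1 + (θ / 2) • (E2 + E3) = 1 ∧ E2 - E3 = vecMulVec ![0, 1, 1] b ∧
      E1 - (1 / 2 : ℝ) • (E2 + E3) = vecMulVec ![0, θ, 1] a) ↔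
      E1 = lamField θ θ 0 a b ∧ E2 = lamField θ (-(1 - θ)) (1 / 2) a b ∧
        E3 = lamField θ (-(1 - θ)) (-(1 / 2)) a b := by
  simp only [lamField]
  constructor
  · rintro ⟨h1, h2, h3⟩
    refine ⟨?_, ?_, ?_⟩
    · linear_combination (norm := module) h1 + θ • h3
    · linear_combination (norm := module) h1 - (1 - θ) • h3 + (1 / 2 : ℝ) • h2
    · linear_combination (norm := module) h1 - (1 - θ) • h3 - (1 / 2 : ℝ) • h2
  · rintro ⟨rfl, rfl, rfl⟩
    refine ⟨?_, ?_, ?_⟩ <;> module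

/-- The laminate system is uniquely solvable as soon as `lamDen κ θ ≠ 0`. -/
lemma lamSys_iff {κ θ : ℝ} (hθ : θ ≠ 0) (hD : lamDen κ θ ≠ 0)
    (E1 E2 E3 : Matrix (Fin 3) (Fin 3) ℝ) (η1 η2 : Fin 3 → ℝ) :
    LamSys θ κ sig3 E1 E2 E3 η1 η2 ↔
      E1 = lamField θ θ 0 (outerAmp κ θ) (innerAmp κ θ) ∧
      E2 = lamField θ (-(1 - θ)) (1 / 2) (outerAmp κ θ) (innerAmp κ θ) ∧
      E3 = lamField θ (-(1 - θ)) (-(1 / 2)) (outerAmp κ θ) (innerAmp κ θ) ∧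
      η1 = √(1 + θ ^ 2) • outerAmp κ θ ∧ η2 = √2 • innerAmp κ θ := by
  have hp : (√(1 + θ ^ 2)) ≠ 0 := by positivity
  have hq : √(2 : ℝ) ≠ 0 := by positivity
  have key := amp_system_iff hD ((√(1 + θ ^ 2))⁻¹ • η1) ((√2)⁻¹ • η2)
  rw [inv_smul_eq_iff₀ hp, inv_smul_eq_iff₀ hq] at key
  rw [LamSys, xi1_eq_smul, xi2_eq_smul, smul_vecMulVec, smul_vecMulVec, ← vecMulVec_smul,
    ← vecMulVec_smul, transpose_mulVec_smul_eq_zero (inv_ne_zero hp),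
    transpose_mulVec_smul_eq_zero (inv_ne_zero hq), ← and_assoc (b := E2 - E3 = _),
    ← and_assoc (b := E1 - _ = _), and_assoc (b := E2 - E3 = _), fields_iff]
  constructor
  · rintro ⟨⟨rfl, rfl, rfl⟩, h4, h5⟩
    obtain ⟨rfl, rfl⟩ := key.1
      ⟨(inner_flux_eq_zero_iff ..).1 h4, (outer_flux_eq_zero_iff κ hθ ..).1 h5⟩
    simp [smul_smul, inv_mul_cancel₀ hp]
  · rintro ⟨rfl, rfl, rfl, h⟩
    have h' := key.2 h
    obtain ⟨rfl, rfl⟩ := h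
    rw [inv_smul_smul₀ hp, inv_smul_smul₀ hq] at h' ⊢
    exact ⟨⟨rfl, rfl, rfl⟩, (inner_flux_eq_zero_iff ..).2 h'.1,
      (outer_flux_eq_zero_iff κ hθ ..).2 h'.2⟩

lemma Delta12_lamField (θ s t : ℝ) (a b : Fin 3 → ℝ) :
    Delta12 (lamField θ s t a b) = 1 + s * θ * a 1 + t * b 1 := by
  simp [Delta12, lamField_apply, mul_assoc]

lemma tendsto_lamDen (κ : ℝ) : Tendsto (lamDen κ) (𝓝[>] 0) (𝓝 (17 / 12)) := by
  have h : Continuous (lamDen κ) := by unfold lamDen; fun_prop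
  refine (h.tendsto' 0 _ ?_).mono_left nhdsWithin_le_nhds
  norm_num [lamDen]

lemma tendsto_mul_outerAmp (κ : ℝ) :
    Tendsto (fun θ => θ * outerAmp κ θ 1) (𝓝[>] 0) (𝓝 (-(12 * κ / 17))) := by
  have hnum : Tendsto (fun θ : ℝ => 3 * θ ^ 2 / 2 - κ - θ * (1 + θ) / 12) (𝓝[>] 0) (𝓝 (-κ)) :=
    ((by fun_prop : Continuous _).tendsto' 0 _ (by simp)).mono_left nhdsWithin_le_nhds
  have h := hnum.div (tendsto_lamDen κ) (by norm_num)
  rw [show -κ / (17 / 12) = -(12 * κ / 17) by ring] at h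
  refine h.congr' ?_
  filter_upwards [self_mem_nhdsWithin] with θ (hθ : 0 < θ)
  have : θ * (3 * θ / 2 - κ / θ - (1 + θ) / 12) = 3 * θ ^ 2 / 2 - κ - θ * (1 + θ) / 12 := by
    field_simp
  change (3 * θ ^ 2 / 2 - κ - θ * (1 + θ) / 12) / lamDen κ θ =
    θ * ((3 * θ / 2 - κ / θ - (1 + θ) / 12) / lamDen κ θ)
  rw [← this, mul_div_assoc]

lemma tendsto_mul_innerAmp (κ : ℝ) :
    Tendsto (fun θ => θ * innerAmp κ θ 1) (𝓝[>] 0) (𝓝 (4 * κ / 17)) := by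
  have hid : Tendsto (fun θ : ℝ => θ) (𝓝[>] 0) (𝓝 0) := nhdsWithin_le_nhds
  have h := (hid.sub (((hid.pow 2).const_sub 1).mul (tendsto_mul_outerAmp κ))).div_const 3
  convert h using 2
  · rw [innerAmp]; ring
  · ring

lemma tendsto_mul_Delta12_lamField (κ t : ℝ) :
    Tendsto (fun θ => θ * Delta12 (lamField θ (-(1 - θ)) t (outerAmp κ θ) (innerAmp κ θ)))
      (𝓝[>] 0) (𝓝 (t * (4 * κ / 17))) := by
  have hid : Tendsto (fun θ : ℝ => θ) (𝓝[>] 0) (𝓝 0) := nhdsWithin_le_nhds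
  have h := (hid.sub ((hid.mul (hid.const_sub 1)).mul (tendsto_mul_outerAmp κ))).add
    ((tendsto_mul_innerAmp κ).const_mul t)
  convert h using 2
  · rw [Delta12_lamField]; ring
  · ring

theorem stmt_4 (κ : ℝ) (hκ : 0 < κ) :
    ∃ θ₀ > (0 : ℝ), ∃ E1 E2 E3 : ℝ → Matrix (Fin 3) (Fin 3) ℝ,
      ∃ η1 η2 : ℝ → (Fin 3 → ℝ),
      (∀ θ ∈ Set.Ioo 0 θ₀,
        LamSys θ κ sig3 (E1 θ) (E2 θ) (E3 θ) (η1 θ) (η2 θ) ∧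
        ∀ F1 F2 F3 ζ1 ζ2, LamSys θ κ sig3 F1 F2 F3 ζ1 ζ2 →
          F1 = E1 θ ∧ F2 = E2 θ ∧ F3 = E3 θ ∧ ζ1 = η1 θ ∧ ζ2 = η2 θ) ∧
      Filter.Tendsto (fun θ => θ * Delta12 (E3 θ))
        (nhdsWithin 0 (Set.Ioi 0)) (nhds (-(2 * κ / 17))) ∧
      Filter.Tendsto (fun θ => θ * Delta12 (E2 θ))
        (nhdsWithin 0 (Set.Ioi 0)) (nhds (2 * κ / 17)) ∧
      ∀ θ ∈ Set.Ioo 0 θ₀,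
        Delta12 (E2 θ) ≠ 0 ∧ Delta12 (E3 θ) ≠ 0 ∧
          Delta12 (E2 θ) * Delta12 (E3 θ) < 0 := by
  have hE3 := tendsto_mul_Delta12_lamField κ (-(1 / 2))
  have hE2 := tendsto_mul_Delta12_lamField κ (1 / 2)
  rw [show -(1 / 2) * (4 * κ / 17) = -(2 * κ / 17) by ring] at hE3
  rw [show 1 / 2 * (4 * κ / 17) = 2 * κ / 17 by ring] at hE2
  have hlim : 0 < 2 * κ / 17 := by positivity
  obtain ⟨θ₀, hθ₀, hsmall⟩ := mem_nhdsGT_iff_exists_Ioo_subset.1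
    ((tendsto_lamDen κ).eventually_ne (by norm_num : (17 / 12 : ℝ) ≠ 0) |>.and <|
      (hE2.eventually_const_lt hlim).and (hE3.eventually_lt_const (neg_lt_zero.2 hlim)))
  refine ⟨θ₀, hθ₀, fun θ => lamField θ θ 0 (outerAmp κ θ) (innerAmp κ θ), _, _,
    fun θ => √(1 + θ ^ 2) • outerAmp κ θ, fun θ => √2 • innerAmp κ θ,
    fun θ hθ => ?_, hE3, hE2, fun θ hθ => ?_⟩
  · have hiff := lamSys_iff hθ.1.ne' (hsmall hθ).1
    exact ⟨(hiff ..).2 ⟨rfl, rfl, rfl, rfl, rfl⟩, fun F1 F2 F3 ζ1 ζ2 => (hiff F1 F2 F3 ζ1 ζ2).1⟩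
  · obtain ⟨-, h2, h3⟩ := hsmall hθ
    have h2' := (pos_iff_pos_of_mul_pos h2).1 hθ.1
    have h3' := neg_of_mul_neg_right h3 hθ.1.le
    exact ⟨h2'.ne', h3'.ne, mul_neg_of_pos_of_neg h2' h3'⟩
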